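/- Let N ≥ 1, let Ω ⊆ ℝ^N be a bounded open nonempty set and let p > N. Then there is a constant C = C(p, N, Ω) such that for every u ∈ C_c^∞(Ω): ∫_Ω |u(x)|^p d(x)^{−p} dx ≤ C ∫_Ω ‖∇u(x)‖^p dx (the Hardy inequality for Ω, valid without any regularity assumption on ∂Ω). -/

import Mathlib

open MeasureTheory

noncomputable section

/-- Euclidean space `ℝ^N`. -/
abbrev Euc (N : ℕ) := EuclideanSpace ℝ (Fin N)

/-- `d(x) = dist(x, ℝ^N \ Ω)`, the distance to the complement of `Ω`. -/
def dw {N : ℕ} (Ω : Set (Euc N)) (x : Euc N) : ℝ := Metric.infDist x Ωᶜ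

/-- A test function: smooth with compact support contained in `Ω`. -/
def IsTestFun {N : ℕ} (Ω : Set (Euc N)) (φ : Euc N → ℝ) : Prop :=
  ContDiff ℝ (⊤ : ℕ∞) φ ∧ HasCompactSupport φ ∧ tsupport φ ⊆ Ω


open Set Metric
open scoped ENNReal

section Voronoi

variable {X : Type*} [PseudoMetricSpace X]

/-- The points of `X` whose nearest point among `y j`, `j ∈ t`, is `y i`, ties being resolved
in favour of the smallest index. -/
def voronoiCell (y : ℕ → X) (t : Finset ℕ) (i : ℕ) : Set X :=
  {x | ∀ j ∈ t, dist x (y i) ≤ dist x (y j) ∧ (j < i → dist x (y i) < dist x (y j))}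

theorem pairwiseDisjoint_voronoiCell (y : ℕ → X) (t : Finset ℕ) :
    (t : Set ℕ).PairwiseDisjoint (voronoiCell y t) := by
  intro i hi j hj hij
  refine Set.disjoint_left.2 fun x hxi hxj => ?_
  rcases lt_or_gt_of_ne hij with h | h
  · exact absurd ((hxj i hi).2 h) (not_lt.2 (hxi j hj).1)
  · exact absurd ((hxi j hj).2 h) (not_lt.2 (hxj i hi).1)

theorem exists_mem_voronoiCell (y : ℕ → X) {t : Finset ℕ} (ht : t.Nonempty) (x : X) :
    ∃ i ∈ t, x ∈ voronoiCell y t i := by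
  obtain ⟨i, hi, hmin⟩ := t.exists_min_image (fun i => toLex (dist x (y i), i)) ht
  refine ⟨i, hi, fun j hj => ?_⟩
  have h := hmin j hj
  rw [Prod.Lex.le_iff] at h
  simp only [ofLex_toLex] at h
  rcases h with h | ⟨h, h'⟩
  · exact ⟨h.le, fun _ => h⟩
  · exact ⟨h.le, fun hji => absurd hji (not_lt.2 h')⟩

theorem exists_finset_dist_lt_two_mul_infDist [TopologicalSpace.SeparableSpace X] {F : Set X}
    (hF : IsClosed F) (hne : F.Nonempty) :
    ∃ y : ℕ → X, (∀ i, y i ∈ F) ∧ ∀ K : Set X, IsCompact K → Disjoint K F →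
      ∃ t : Finset ℕ, ∀ x ∈ K, ∃ i ∈ t, dist x (y i) < 2 * infDist x F := by
  have : SecondCountableTopology X := UniformSpace.secondCountable_of_separable X
  have : Nonempty F := hne.to_subtype
  obtain ⟨y, hy⟩ := TopologicalSpace.exists_dense_seq F
  refine ⟨fun i => y i, fun i => (y i).2, fun K hK hKF => ?_⟩
  obtain ⟨t, ht⟩ := hK.elim_finite_subcover
    (fun i => {x | dist x (y i : X) < 2 * infDist x F})
    (fun i => isOpen_lt (by fun_prop) (continuous_const.mul (continuous_infDist_pt F)))
    (fun x hx => by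
      have hpos : 0 < infDist x F :=
        (hF.notMem_iff_infDist_pos hne).1 (Set.disjoint_left.1 hKF hx)
      obtain ⟨z, hz, hxz⟩ := (infDist_lt_iff hne).1
        (show infDist x F < 3 / 2 * infDist x F by linarith)
      obtain ⟨i, hi⟩ := hy.exists_dist_lt ⟨z, hz⟩ (half_pos hpos)
      refine mem_iUnion.2 ⟨i, ?_⟩
      have := dist_triangle x z (y i)
      rw [Subtype.dist_eq] at hi
      simp only [mem_ofPred_eq]
      linarith)
  exact ⟨t, fun x hx => by simpa using ht hx⟩

theorem measurableSet_voronoiCell [MeasurableSpace X] [OpensMeasurableSpace X] (y : ℕ → X)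
    (t : Finset ℕ) (i : ℕ) :
    MeasurableSet (voronoiCell y t i) := by
  have : voronoiCell y t i = ⋂ j ∈ t, ({x | dist x (y i) ≤ dist x (y j)} ∩
      {x | j < i → dist x (y i) < dist x (y j)}) := by
    ext x
    simp [voronoiCell]
  rw [this]
  refine Finset.measurableSet_biInter _ fun j _ => MeasurableSet.inter ?_ ?_
  · exact (isClosed_le (by fun_prop) (by fun_prop)).measurableSet
  · by_cases h : j < i
    · simpa [h] using (isOpen_lt (by fun_prop) (by fun_prop)).measurableSet
    · simp [h]

end Voronoi

section Hardy

variable {E : Type*} [NormedAddCommGroup E] [NormedSpace ℝ E]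

theorem enorm_le_lintegral_fderiv_segment {u : E → ℝ} (hu : ContDiff ℝ 1 u) {y : E}
    (hy : u y = 0) (x : E) :
    ‖u x‖ₑ ≤ ‖x - y‖ₑ * ∫⁻ s in Ioo (0 : ℝ) 1, ‖fderiv ℝ u (y + s • (x - y))‖ₑ := by
  have hc : Continuous fun s : ℝ => fderiv ℝ u (y + s • (x - y)) :=
    (hu.continuous_fderiv one_ne_zero).comp (by fun_prop)
  have hd : ∀ s : ℝ, HasDerivAt (fun s : ℝ => u (y + s • (x - y)))
      (fderiv ℝ u (y + s • (x - y)) (x - y)) s := by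
    intro s
    have h1 : HasDerivAt (fun s : ℝ => y + s • (x - y)) (x - y) s := by
      simpa using ((hasDerivAt_id s).smul_const (x - y)).const_add y
    exact ((hu.differentiable one_ne_zero) _).hasFDerivAt.comp_hasDerivAt s h1
  have hftc := intervalIntegral.integral_eq_sub_of_hasDerivAt (a := 0) (b := 1)
    (fun s _ => hd s) ((hc.clm_apply continuous_const).intervalIntegrable _ _)
  simp only [one_smul, zero_smul, add_zero, hy, sub_zero, add_sub_cancel] at hftc
  rw [← hftc, intervalIntegral.integral_of_le zero_le_one, integral_Ioc_eq_integral_Ioo]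
  refine (enorm_integral_le_lintegral_enorm _).trans ?_
  rw [← lintegral_const_mul' _ _ enorm_ne_top]
  refine lintegral_mono fun s => ?_
  rw [mul_comm]
  exact ContinuousLinearMap.le_opENorm _ _

theorem rpow_lintegral_Ioo_le_weighted {p q : ℝ} (hpq : p.HolderConjugate q) (a : ℝ)
    {g : ℝ → ℝ≥0∞} (hg : Measurable g) :
    (∫⁻ s in Ioo (0 : ℝ) 1, g s) ^ p ≤
      (∫⁻ s in Ioo (0 : ℝ) 1, ENNReal.ofReal (s ^ (-(a * q)))) ^ (p / q) *
        ∫⁻ s in Ioo (0 : ℝ) 1, ENNReal.ofReal (s ^ (a * p)) * g s ^ p := by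
  have hp := hpq.pos
  have hq := hpq.symm.pos
  have h := ENNReal.lintegral_mul_le_Lp_mul_Lq (volume.restrict (Ioo (0 : ℝ) 1)) hpq.symm
    (f := fun s => ENNReal.ofReal (s ^ (-a))) (g := fun s => ENNReal.ofReal (s ^ a) * g s)
    (by fun_prop) (by fun_prop)
  have e0 : ∫⁻ s in Ioo (0 : ℝ) 1, g s = ∫⁻ s in Ioo (0 : ℝ) 1,
      ((fun s => ENNReal.ofReal (s ^ (-a))) * fun s => ENNReal.ofReal (s ^ a) * g s) s := by
    refine setLIntegral_congr_fun measurableSet_Ioo fun s hs => ?_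
    simp only [Pi.mul_apply]
    rw [← mul_assoc, ← ENNReal.ofReal_mul (Real.rpow_nonneg hs.1.le _), ← Real.rpow_add hs.1]
    simp
  have e1 : ∫⁻ s in Ioo (0 : ℝ) 1, ENNReal.ofReal (s ^ (-a)) ^ q =
      ∫⁻ s in Ioo (0 : ℝ) 1, ENNReal.ofReal (s ^ (-(a * q))) := by
    refine setLIntegral_congr_fun measurableSet_Ioo fun s hs => ?_
    rw [ENNReal.ofReal_rpow_of_nonneg (Real.rpow_nonneg hs.1.le _) hq.le,
      ← Real.rpow_mul hs.1.le, neg_mul]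
  have e2 : ∫⁻ s in Ioo (0 : ℝ) 1, (ENNReal.ofReal (s ^ a) * g s) ^ p =
      ∫⁻ s in Ioo (0 : ℝ) 1, ENNReal.ofReal (s ^ (a * p)) * g s ^ p := by
    refine setLIntegral_congr_fun measurableSet_Ioo fun s hs => ?_
    rw [ENNReal.mul_rpow_of_nonneg _ _ hp.le,
      ENNReal.ofReal_rpow_of_nonneg (Real.rpow_nonneg hs.1.le _) hp.le, ← Real.rpow_mul hs.1.le]
  rw [← e0, e1, e2] at h
  refine (ENNReal.rpow_le_rpow h hp.le).trans_eq ?_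
  rw [ENNReal.mul_rpow_of_nonneg _ _ hp.le, ← ENNReal.rpow_mul, ← ENNReal.rpow_mul,
    one_div_mul_cancel hp.ne', ENNReal.rpow_one, one_div_mul_eq_div]

theorem add_smul_sub_mem_voronoiCell {y : ℕ → E} {t : Finset ℕ} {i : ℕ} {s : ℝ}
    (hs : s ∈ Ioo (0 : ℝ) 1) {x : E} (hx : x ∈ voronoiCell y t i) :
    y i + s • (x - y i) ∈ voronoiCell y t i := by
  have h1 : dist (y i + s • (x - y i)) (y i) = s * dist x (y i) := by
    rw [dist_eq_norm, add_sub_cancel_left, norm_smul, Real.norm_of_nonneg hs.1.le, dist_eq_norm]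
  have h2 : dist x (y i + s • (x - y i)) = (1 - s) * dist x (y i) := by
    rw [dist_eq_norm, show x - (y i + s • (x - y i)) = (1 - s) • (x - y i) by module, norm_smul,
      Real.norm_of_nonneg (sub_nonneg.2 hs.2.le), dist_eq_norm]
  intro j hj
  obtain ⟨hle, hlt⟩ := hx j hj
  have h3 := dist_triangle x (y i + s • (x - y i)) (y j)
  refine ⟨by linarith, fun hji => ?_⟩
  have := hlt hji
  linarith

variable [MeasurableSpace E] [BorelSpace E] [FiniteDimensional ℝ E]
  (μ : Measure E) [μ.IsAddHaarMeasure]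

theorem setLIntegral_comp_dilation_le {V : Set E} (hV : MeasurableSet V) {y : E} {s : ℝ}
    (hs : 0 < s) (hstar : ∀ x ∈ V, y + s • (x - y) ∈ V) {g : E → ℝ≥0∞} (hg : Measurable g) :
    ∫⁻ x in V, g (y + s • (x - y)) ∂μ ≤
      ENNReal.ofReal (s ^ (-(Module.finrank ℝ E : ℝ))) * ∫⁻ x in V, g x ∂μ := by
  rw [← lintegral_indicator hV, ← lintegral_indicator hV]
  have hG : Measurable (V.indicator g) := hg.indicator hV
  calc ∫⁻ x, V.indicator (fun x => g (y + s • (x - y))) x ∂μ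
      ≤ ∫⁻ x, V.indicator g (y + s • (x - y)) ∂μ := by
        refine lintegral_mono fun x => ?_
        by_cases hx : x ∈ V
        · simp [hx, hstar x hx]
        · simp [hx]
    _ = ∫⁻ x, V.indicator g (y + s • x) ∂μ :=
        lintegral_sub_right_eq_self (fun x => V.indicator g (y + s • x)) y
    _ = ∫⁻ x, V.indicator g (y + x) ∂(μ.map (s • ·)) := by
        rw [lintegral_map (by fun_prop) (by fun_prop)]
    _ = _ := by
        rw [Measure.map_addHaar_smul μ hs.ne', lintegral_smul_measure,
          lintegral_add_left_eq_self (fun x => V.indicator g x) y, smul_eq_mul,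
          Real.rpow_neg hs.le, Real.rpow_natCast, abs_of_pos (by positivity)]

/-- Hardy inequality with respect to one point `y`, on a set that is star-shaped about `y`. -/
theorem setLIntegral_hardy_of_star {p q : ℝ} (hpq : p.HolderConjugate q) (a : ℝ) {V : Set E}
    (hV : MeasurableSet V) {y : E} (hstar : ∀ s ∈ Ioo (0 : ℝ) 1, ∀ x ∈ V, y + s • (x - y) ∈ V)
    {u : E → ℝ} (hu : ContDiff ℝ 1 u) (hy : u y = 0) :
    ∫⁻ x in V, (‖u x‖ₑ / ‖x - y‖ₑ) ^ p ∂μ ≤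
      (∫⁻ s in Ioo (0 : ℝ) 1, ENNReal.ofReal (s ^ (-(a * q)))) ^ (p / q) *
        (∫⁻ s in Ioo (0 : ℝ) 1, ENNReal.ofReal (s ^ (a * p - Module.finrank ℝ E))) *
        ∫⁻ x in V, ‖fderiv ℝ u x‖ₑ ^ p ∂μ := by
  have hp := hpq.pos
  have hc : Continuous (fderiv ℝ u) := hu.continuous_fderiv one_ne_zero
  have hm : Measurable fun x => ‖fderiv ℝ u x‖ₑ := hc.enorm.measurable
  have hm2 : Measurable fun z : E × ℝ => ‖fderiv ℝ u (y + z.2 • (z.1 - y))‖ₑ :=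
    (hc.comp (by fun_prop : Continuous fun z : E × ℝ => y + z.2 • (z.1 - y))).enorm.measurable
  set K := (∫⁻ s in Ioo (0 : ℝ) 1, ENNReal.ofReal (s ^ (-(a * q)))) ^ (p / q)
  calc ∫⁻ x in V, (‖u x‖ₑ / ‖x - y‖ₑ) ^ p ∂μ
      ≤ ∫⁻ x in V, K * (∫⁻ s in Ioo (0 : ℝ) 1,
          ENNReal.ofReal (s ^ (a * p)) * ‖fderiv ℝ u (y + s • (x - y))‖ₑ ^ p) ∂μ := by
        refine lintegral_mono fun x => ?_
        have hmx : Measurable fun s : ℝ => ‖fderiv ℝ u (y + s • (x - y))‖ₑ :=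
          (hc.comp (by fun_prop : Continuous fun s : ℝ => y + s • (x - y))).enorm.measurable
        exact (ENNReal.rpow_le_rpow (ENNReal.div_le_of_le_mul'
          (enorm_le_lintegral_fderiv_segment hu hy x)) hp.le).trans
          (rpow_lintegral_Ioo_le_weighted hpq a hmx)
    _ = K * ∫⁻ s in Ioo (0 : ℝ) 1, ENNReal.ofReal (s ^ (a * p)) *
          (∫⁻ x in V, ‖fderiv ℝ u (y + s • (x - y))‖ₑ ^ p ∂μ) := by
        have hm3 : Measurable fun z : E × ℝ => ENNReal.ofReal (z.2 ^ (a * p)) *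
            ‖fderiv ℝ u (y + z.2 • (z.1 - y))‖ₑ ^ p :=
          (by fun_prop : Measurable fun z : E × ℝ => ENNReal.ofReal (z.2 ^ (a * p))).mul
            (hm2.pow_const p)
        rw [lintegral_const_mul _ hm3.lintegral_prod_right',
          lintegral_lintegral_swap hm3.aemeasurable]
        congr 1
        refine lintegral_congr fun s => ?_
        have hms : Measurable fun x : E => ‖fderiv ℝ u (y + s • (x - y))‖ₑ :=
          (hc.comp (by fun_prop : Continuous fun x : E => y + s • (x - y))).enorm.measurable
        dsimp only
        rw [lintegral_const_mul _ (hms.pow_const p)]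
    _ ≤ K * ∫⁻ s in Ioo (0 : ℝ) 1, ENNReal.ofReal (s ^ (a * p - Module.finrank ℝ E)) *
          (∫⁻ x in V, ‖fderiv ℝ u x‖ₑ ^ p ∂μ) := by
        refine mul_le_mul_right (setLIntegral_mono' measurableSet_Ioo fun s hs => ?_) K
        grw [setLIntegral_comp_dilation_le μ hV hs.1 (hstar s hs) (hm.pow_const p)]
        rw [← mul_assoc, ← ENNReal.ofReal_mul (Real.rpow_nonneg hs.1.le _), ← Real.rpow_add hs.1,
          sub_eq_add_neg]
    _ = _ := by
        rw [lintegral_mul_const _ (by fun_prop), mul_assoc]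

/-- Hardy inequality for the distance to an arbitrary nonempty closed set. -/
theorem lintegral_div_infDist_rpow_le {p q : ℝ} (hpq : p.HolderConjugate q) (a : ℝ) {F : Set E}
    (hF : IsClosed F) (hne : F.Nonempty) {u : E → ℝ} (hu : ContDiff ℝ 1 u)
    (hsupp : HasCompactSupport u) (hdisj : Disjoint (tsupport u) F) :
    ∫⁻ x, (‖u x‖ₑ / ENNReal.ofReal (infDist x F)) ^ p ∂μ ≤
      2 ^ p * ((∫⁻ s in Ioo (0 : ℝ) 1, ENNReal.ofReal (s ^ (-(a * q)))) ^ (p / q) *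
        (∫⁻ s in Ioo (0 : ℝ) 1, ENNReal.ofReal (s ^ (a * p - Module.finrank ℝ E)))) *
        ∫⁻ x, ‖fderiv ℝ u x‖ₑ ^ p ∂μ := by
  have hp := hpq.pos
  have : ProperSpace E := FiniteDimensional.proper ℝ E
  obtain ⟨y, hyF, hy⟩ := exists_finset_dist_lt_two_mul_infDist hF hne
  obtain ⟨t₀, ht₀⟩ := hy _ hsupp hdisj
  set t := insert 0 t₀
  have hcover : ⋃ i ∈ t, voronoiCell y t i = univ := by
    refine eq_univ_of_forall fun x => ?_
    obtain ⟨i, hi, hx⟩ := exists_mem_voronoiCell y (Finset.insert_nonempty 0 t₀) x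
    exact mem_biUnion hi hx
  have hsplit : ∀ f : E → ℝ≥0∞, ∫⁻ x, f x ∂μ = ∑ i ∈ t, ∫⁻ x in voronoiCell y t i, f x ∂μ := by
    intro f
    rw [← lintegral_biUnion_finset (pairwiseDisjoint_voronoiCell y t)
      (fun i _ => measurableSet_voronoiCell y t i), hcover, setLIntegral_univ]
  rw [hsplit, hsplit, Finset.mul_sum]
  refine Finset.sum_le_sum fun i _ => ?_
  have hyi : u (y i) = 0 :=
    image_eq_zero_of_notMem_tsupport fun h => Set.disjoint_left.1 hdisj h (hyF i)
  have hstar := setLIntegral_hardy_of_star μ hpq a (measurableSet_voronoiCell y t i)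
    (fun s hs x hx => add_smul_sub_mem_voronoiCell hs hx) hu hyi
  rw [mul_assoc]
  grw [← hstar]
  rw [← lintegral_const_mul' _ _ (by finiteness)]
  refine setLIntegral_mono' (measurableSet_voronoiCell y t i) fun x hx => ?_
  rw [← ENNReal.mul_rpow_of_nonneg _ _ hp.le]
  refine ENNReal.rpow_le_rpow ?_ hp.le
  by_cases hux : u x = 0
  · simp [hux]
  obtain ⟨j, hj, hxj⟩ := ht₀ x (subset_tsupport u hux)
  have hle : ‖x - y i‖ₑ ≤ 2 * ENNReal.ofReal (infDist x F) := by
    rw [← ofReal_norm, ← dist_eq_norm,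
      ← ENNReal.ofReal_ofNat 2, ← ENNReal.ofReal_mul zero_le_two]
    exact ENNReal.ofReal_le_ofReal
      (((hx j (Finset.mem_insert_of_mem hj)).1.trans hxj.le))
  calc ‖u x‖ₑ / ENNReal.ofReal (infDist x F)
      = 2 * (‖u x‖ₑ / (2 * ENNReal.ofReal (infDist x F))) := by
        rw [← mul_div_assoc, ENNReal.mul_div_mul_left _ _ two_ne_zero ENNReal.ofNat_ne_top]
    _ ≤ _ := by gcongr

end Hardy

theorem lintegral_Ioo_rpow_lt_top {r : ℝ} (hr : -1 < r) :
    ∫⁻ s in Ioo (0 : ℝ) 1, ENNReal.ofReal (s ^ r) < ∞ := by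
  have h : IntegrableOn (fun s : ℝ => s ^ r) (Ioo 0 1) :=
    (intervalIntegral.integrableOn_Ioo_rpow_iff one_pos).2 hr
  exact h.lintegral_lt_top

/-- **Ancona's Hardy inequality**: for `Ω ⊆ ℝ^N` bounded open nonempty and
`p > N`, there is `C = C(p, N, Ω)` with
`∫_Ω |u|^p d(x)^{-p} dx ≤ C ∫_Ω ‖∇u‖^p dx` for all `u ∈ C_c^∞(Ω)`,
with no regularity assumption on `∂Ω`. -/
theorem ancona_hardy_inequality {N : ℕ} (hN : 1 ≤ N) (Ω : Set (Euc N))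
    (hΩ : IsOpen Ω) (hb : Bornology.IsBounded Ω) (hne : Ω.Nonempty)
    (p : ℝ) (hp : (N : ℝ) < p) :
    ∃ C : ℝ, 0 < C ∧ ∀ u : Euc N → ℝ, IsTestFun Ω u →
      ∫ x in Ω, |u x| ^ p * dw Ω x ^ (-p) ≤
        C * ∫ x in Ω, ‖fderiv ℝ u x‖ ^ p := by
  have hN' : (1 : ℝ) ≤ N := by exact_mod_cast hN
  have hp1 : 1 < p := hN'.trans_lt hp
  have hp0 : 0 < p := one_pos.trans hp1
  have hpq := Real.HolderConjugate.conjExponent hp1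
  have : Nonempty (Fin N) := Fin.pos_iff_nonempty.1 hN
  have hF : Ωᶜ.Nonempty := by
    refine nonempty_compl.2 fun h => ?_
    exact NormedSpace.unbounded_univ ℝ (Euc N) (h ▸ hb)
  set q := Real.conjExponent p with hq
  set a : ℝ := (N + p - 2) / (2 * p) with ha
  have hap : a * p = (N + p - 2) / 2 := by rw [ha]; field_simp
  have haq : a * q < 1 := by
    have : 0 < p - 1 := by linarith
    have : a * q = (N + p - 2) / (2 * (p - 1)) := by
      rw [ha, hq, Real.conjExponent]; field_simp
    rw [this, div_lt_one (by positivity)]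
    linarith
  have h1 : ∫⁻ s in Ioo (0 : ℝ) 1, ENNReal.ofReal (s ^ (-(a * q))) < ∞ :=
    lintegral_Ioo_rpow_lt_top (by linarith)
  have h2 : ∫⁻ s in Ioo (0 : ℝ) 1, ENNReal.ofReal (s ^ (a * p - Module.finrank ℝ (Euc N))) < ∞ :=
    lintegral_Ioo_rpow_lt_top (by rw [finrank_euclideanSpace_fin, hap]; linarith)
  set C : ℝ≥0∞ := 2 ^ p *
    ((∫⁻ s in Ioo (0 : ℝ) 1, ENNReal.ofReal (s ^ (-(a * q)))) ^ (p / q) *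
      ∫⁻ s in Ioo (0 : ℝ) 1, ENNReal.ofReal (s ^ (a * p - Module.finrank ℝ (Euc N)))) with hC
  have hCtop : C ≠ ∞ :=
    ENNReal.mul_ne_top (ENNReal.rpow_ne_top_of_nonneg hp0.le ENNReal.ofNat_ne_top)
      (ENNReal.mul_ne_top (ENNReal.rpow_ne_top_of_nonneg
        (div_nonneg hp0.le hpq.symm.nonneg) h1.ne) h2.ne)
  refine ⟨C.toReal + 1, by positivity, fun u ⟨hu, hsupp, hsub⟩ => ?_⟩
  have hu1 : ContDiff ℝ 1 u := hu.of_le (by exact_mod_cast le_top)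
  have hgc : Continuous fun x => ‖fderiv ℝ u x‖ ^ p :=
    (hu1.continuous_fderiv one_ne_zero).norm.rpow_const fun _ => Or.inr hp0.le
  have hgs : HasCompactSupport fun x => ‖fderiv ℝ u x‖ ^ p :=
    (hsupp.fderiv (𝕜 := ℝ)).comp_left (g := fun v => ‖v‖ ^ p) (by simp [hp0.ne'])
  have hgi : Integrable fun x => ‖fderiv ℝ u x‖ ^ p := hgc.integrable_of_hasCompactSupport hgs
  have hg0 : 0 ≤ ∫ x in Ω, ‖fderiv ℝ u x‖ ^ p := by positivity
  have hgΩ : ∫ x in Ω, ‖fderiv ℝ u x‖ ^ p = ∫ x, ‖fderiv ℝ u x‖ ^ p := by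
    refine setIntegral_eq_integral_of_forall_compl_eq_zero fun x hx => ?_
    have : fderiv ℝ u x = 0 := by
      by_contra h
      exact hx (hsub (support_fderiv_subset ℝ h))
    simp [this, hp0.ne']
  have hnorm : ∀ v : Euc N →L[ℝ] ℝ, ENNReal.ofReal (‖v‖ ^ p) = ‖v‖ₑ ^ p := fun v => by
    rw [← ENNReal.ofReal_rpow_of_nonneg (norm_nonneg _) hp0.le, ofReal_norm]
  have hgl : ∫⁻ x, ‖fderiv ℝ u x‖ₑ ^ p = ENNReal.ofReal (∫ x in Ω, ‖fderiv ℝ u x‖ ^ p) := by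
    rw [hgΩ, ofReal_integral_eq_lintegral_ofReal hgi (ae_of_all _ fun x => by positivity)]
    simp only [hnorm]
  have hmain := lintegral_div_infDist_rpow_le volume hpq a hΩ.isClosed_compl hF hu1 hsupp
    (disjoint_compl_right_iff_subset.2 hsub)
  rw [← hC, hgl] at hmain
  have hl : ∫⁻ x in Ω, ENNReal.ofReal (|u x| ^ p * dw Ω x ^ (-p)) ≤
      C * ENNReal.ofReal (∫ x in Ω, ‖fderiv ℝ u x‖ ^ p) := by
    refine le_trans ?_ ((setLIntegral_le_lintegral Ω _).trans hmain)
    refine setLIntegral_mono' hΩ.measurableSet fun x hx => le_of_eq ?_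
    have hd : 0 < infDist x Ωᶜ :=
      (hΩ.isClosed_compl.notMem_iff_infDist_pos hF).1 (by simpa using hx)
    rw [dw, Real.rpow_neg hd.le, ← div_eq_mul_inv, ← Real.div_rpow (abs_nonneg _) hd.le,
      ← ENNReal.ofReal_rpow_of_nonneg (by positivity) hp0.le, ENNReal.ofReal_div_of_pos hd,
      ← Real.norm_eq_abs, ofReal_norm]
  calc ∫ x in Ω, |u x| ^ p * dw Ω x ^ (-p)
      ≤ (∫⁻ x in Ω, ENNReal.ofReal (|u x| ^ p * dw Ω x ^ (-p))).toReal := by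
        by_cases hi : Integrable (fun x => |u x| ^ p * dw Ω x ^ (-p)) (volume.restrict Ω)
        · refine (integral_eq_lintegral_of_nonneg_ae (ae_of_all _ fun x => ?_)
            hi.aestronglyMeasurable).le
          have : 0 ≤ dw Ω x := infDist_nonneg
          positivity
        · rw [integral_undef hi]
          positivity
    _ ≤ C.toReal * ∫ x in Ω, ‖fderiv ℝ u x‖ ^ p := by
        refine (ENNReal.toReal_mono (by finiteness) hl).trans_eq ?_
        rw [ENNReal.toReal_mul, ENNReal.toReal_ofReal hg0]
    _ ≤ _ := by gcongr; linarith
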